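/- Let X be a GC_n set possessing exactly n+1 maximal lines (a Carnicer–Gasca lattice of degree n), n ≥ 2, and let ℓ be a k-node line of X with 2 ≤ k ≤ n+1. Then there exists an integer s with 2k − n − 1 ≤ s ≤ k such that |X_ℓ| = binomial(s,2), and for every maximal line λ of X, the number of nodes of X_ℓ lying on λ equals either 0 or s − 1. -/

import Mathlib

open MvPolynomial

/-- Bivariate real polynomials. -/
abbrev Poly2 : Type := MvPolynomial (Fin 2) ℝ

/-- Evaluation of a bivariate polynomial at a point of `ℝ²`. -/
noncomputable def evalPt (p : Poly2) (A : ℝ × ℝ) : ℝ :=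
  MvPolynomial.eval (fun i => if i = 0 then A.1 else A.2) p

/-- `X` is an `n`-poised set: it has `(n+2 choose 2)` nodes and the only polynomial of
total degree at most `n` vanishing on all of `X` is the zero polynomial. -/
def IsPoised (n : ℕ) (X : Finset (ℝ × ℝ)) : Prop :=
  X.card = (n + 2).choose 2 ∧
    ∀ p : Poly2, p.totalDegree ≤ n → (∀ A ∈ X, evalPt p A = 0) → p = 0

/-- `p` is an `n`-fundamental polynomial of the node `A` with respect to `X`. -/
def IsFund (n : ℕ) (X : Finset (ℝ × ℝ)) (A : ℝ × ℝ) (p : Poly2) : Prop :=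
  p.totalDegree ≤ n ∧ evalPt p A = 1 ∧ ∀ B ∈ X, B ≠ A → evalPt p B = 0

/-- `X` is a `GC_n` set: `n`-poised and each node has a fundamental polynomial which is
a product of `n` polynomials of degree 1. -/
def IsGC (n : ℕ) (X : Finset (ℝ × ℝ)) : Prop :=
  IsPoised n X ∧
    ∀ A ∈ X, ∃ p : Poly2, IsFund n X A p ∧
      ∃ f : Fin n → Poly2, (∀ i, (f i).totalDegree = 1) ∧ p = ∏ i, f i

/-- The nodes of `X` lying on the zero set of `ℓ`. -/
noncomputable def nodesOn (X : Finset (ℝ × ℝ)) (ℓ : Poly2) : Finset (ℝ × ℝ) :=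
  @Finset.filter _ (fun A => evalPt ℓ A = 0) (Classical.decPred _) X

/-- `ℓ` is a `k`-node line of `X`: it has degree exactly 1 and passes through exactly
`k` nodes of `X`. -/
def IsKNodeLine (X : Finset (ℝ × ℝ)) (ℓ : Poly2) (k : ℕ) : Prop :=
  ℓ.totalDegree = 1 ∧ (nodesOn X ℓ).card = k

/-- A maximal line of an `n`-poised set: an `(n+1)`-node line. -/
def IsMaximalLine (n : ℕ) (X : Finset (ℝ × ℝ)) (ℓ : Poly2) : Prop :=
  IsKNodeLine X ℓ (n + 1)

/-- The zero set of a polynomial, i.e. the line it determines when it has degree 1. -/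
def zeroSet (ℓ : Poly2) : Set (ℝ × ℝ) := {A | evalPt ℓ A = 0}

/-- `μ(X)`: the number of maximal lines (as subsets of the plane) of `X`. -/
noncomputable def mu (n : ℕ) (X : Finset (ℝ × ℝ)) : ℕ :=
  {L : Set (ℝ × ℝ) | ∃ ℓ : Poly2, IsMaximalLine n X ℓ ∧ L = zeroSet ℓ}.ncard

/-- The node `A` of `X` uses the line `ℓ`: `ℓ` divides a fundamental polynomial of `A`. -/
def Uses (n : ℕ) (X : Finset (ℝ × ℝ)) (ℓ : Poly2) (A : ℝ × ℝ) : Prop :=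
  ∃ p : Poly2, IsFund n X A p ∧ ℓ ∣ p

/-- `X_ℓ`: the set of nodes of `X` using the line `ℓ`. -/
noncomputable def usesSet (n : ℕ) (X : Finset (ℝ × ℝ)) (ℓ : Poly2) : Finset (ℝ × ℝ) :=
  @Finset.filter _ (Uses n X ℓ) (Classical.decPred _) X

/-- The Gasca–Maeztu conjecture for degree `m`: every `GC_m` set has a maximal line. -/
def GM (m : ℕ) : Prop :=
  ∀ Y : Finset (ℝ × ℝ), IsGC m Y → ∃ lam : Poly2, IsMaximalLine m Y lam

section AlgebraPart

lemma evalPt_mul (p q : Poly2) (A : ℝ × ℝ) : evalPt (p * q) A = evalPt p A * evalPt q A := by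
  simp [evalPt]

lemma evalPt_C (c : ℝ) (A : ℝ × ℝ) : evalPt (C c) A = c := by
  simp [evalPt]

lemma evalPt_zero (A : ℝ × ℝ) : evalPt 0 A = 0 := by
  simp [evalPt]

lemma evalPt_prod {ι : Type*} (s : Finset ι) (f : ι → Poly2) (A : ℝ × ℝ) :
    evalPt (∏ i ∈ s, f i) A = ∏ i ∈ s, evalPt (f i) A := by
  simp [evalPt]

lemma mem_nodesOn {X : Finset (ℝ × ℝ)} {l : Poly2} {A : ℝ × ℝ} :
    A ∈ nodesOn X l ↔ A ∈ X ∧ evalPt l A = 0 := by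
  simp [nodesOn]

lemma mem_usesSet {n : ℕ} {X : Finset (ℝ × ℝ)} {l : Poly2} {A : ℝ × ℝ} :
    A ∈ usesSet n X l ↔ A ∈ X ∧ Uses n X l A := by
  simp [usesSet]

lemma finsupp_two (m : Fin 2 →₀ ℕ) (h : m.degree ≤ 1) :
    m = 0 ∨ m = Finsupp.single 0 1 ∨ m = Finsupp.single 1 1 := by
  have h' : m 0 + m 1 ≤ 1 := by
    rw [Finsupp.degree_eq_sum, Fin.sum_univ_two] at h
    exact h
  have hc : (m 0 = 0 ∧ m 1 = 0) ∨ (m 0 = 1 ∧ m 1 = 0) ∨ (m 0 = 0 ∧ m 1 = 1) := by omega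
  rcases hc with ⟨a, b⟩ | ⟨a, b⟩ | ⟨a, b⟩
  · left; ext i; fin_cases i <;> simp [a, b]
  · right; left; ext i; fin_cases i <;> simp [a, b]
  · right; right; ext i; fin_cases i <;> simp [a, b]

lemma linear_form (l : Poly2) (h : l.totalDegree ≤ 1) :
    ∃ a b c : ℝ, l = C a * X 0 + C b * X 1 + C c := by
  refine ⟨coeff (Finsupp.single 0 1) l, coeff (Finsupp.single 1 1) l, coeff 0 l, ?_⟩
  have h01 : (Finsupp.single (0 : Fin 2) 1 : Fin 2 →₀ ℕ) ≠ Finsupp.single 1 1 := by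
    intro h
    have := DFunLike.congr_fun h 0
    simp at this
  have z0 : (Finsupp.single (0 : Fin 2) 1 : Fin 2 →₀ ℕ) ≠ 0 := by simp
  have z1 : (Finsupp.single (1 : Fin 2) 1 : Fin 2 →₀ ℕ) ≠ 0 := by simp
  ext m
  by_cases hm : m.degree ≤ 1
  · rcases finsupp_two m hm with rfl | rfl | rfl
    · simp [coeff_C_mul, coeff_X, coeff_C]
    · simp [coeff_C_mul, coeff_X, coeff_C, h01.symm, z0.symm]
    · simp [coeff_C_mul, coeff_X, coeff_C, h01, z1.symm]
  · have h0 : coeff m l = 0 := by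
      apply coeff_eq_zero_of_totalDegree_lt
      have : m.degree = ∑ i ∈ m.support, m i := rfl
      omega
    have e0 : m ≠ 0 := by rintro rfl; simp at hm
    have e1 : m ≠ Finsupp.single 0 1 := by rintro rfl; simp at hm
    have e2 : m ≠ Finsupp.single 1 1 := by rintro rfl; simp at hm
    simp [coeff_C_mul, coeff_X, coeff_C, h0, e0.symm, e1.symm, e2.symm]

lemma line_form (l : Poly2) (h : l.totalDegree = 1) :
    ∃ a b c : ℝ, a ^ 2 + b ^ 2 ≠ 0 ∧ l = C a * X 0 + C b * X 1 + C c := by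
  obtain ⟨a, b, c, e⟩ := linear_form l h.le
  refine ⟨a, b, c, ?_, e⟩
  intro h0
  have ha : a = 0 := by nlinarith [sq_nonneg a, sq_nonneg b]
  have hb : b = 0 := by nlinarith [sq_nonneg a, sq_nonneg b]
  subst ha hb
  rw [e] at h
  simp at h

lemma line_ne_zero {l : Poly2} (h : l.totalDegree = 1) : l ≠ 0 := by
  rintro rfl; simp at h

lemma const_isUnit {q : Poly2} (hq : q ≠ 0) (h : q.totalDegree = 0) :
    ∃ c : ℝ, c ≠ 0 ∧ q = C c := by
  rw [totalDegree_eq_zero_iff_eq_C] at h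
  refine ⟨_, ?_, h⟩
  intro h0
  rw [h0] at h
  simp at h
  exact hq h

lemma line_irreducible {l : Poly2} (h : l.totalDegree = 1) : Irreducible l := by
  have hl := line_ne_zero h
  constructor
  · intro hu
    obtain ⟨q, hq⟩ := hu.exists_right_inv
    have hq0 : q ≠ 0 := by rintro rfl; simp at hq
    have := totalDegree_mul_of_isDomain hl hq0
    rw [hq] at this
    simp at this
    omega
  · intro a b e
    have ha : a ≠ 0 := by rintro rfl; simp at e; exact hl e
    have hb : b ≠ 0 := by rintro rfl; simp at e; exact hl e
    have := totalDegree_mul_of_isDomain ha hb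
    rw [← e, h] at this
    have hu : ∀ q : Poly2, q ≠ 0 → q.totalDegree = 0 → IsUnit q := by
      intro q hq h0
      obtain ⟨c, hc, rfl⟩ := const_isUnit hq h0
      exact (isUnit_iff_ne_zero.mpr hc).map C
    rcases Nat.eq_zero_or_pos a.totalDegree with h0 | h0
    · exact Or.inl (hu a ha h0)
    · exact Or.inr (hu b hb (by omega))

lemma line_dvd {l p : Poly2} {d : ℕ} (hl : l.totalDegree = 1) (hp : p.totalDegree ≤ d)
    (S : Finset (ℝ × ℝ)) (hS : d < S.card) (hSl : ∀ A ∈ S, evalPt l A = 0)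
    (hSp : ∀ A ∈ S, evalPt p A = 0) : l ∣ p := by
  obtain ⟨a, b, c, hN, e⟩ := line_form l hl
  set N := a ^ 2 + b ^ 2 with hNdef
  set x0 : ℝ := - c * a / N with hx0
  set y0 : ℝ := - c * b / N with hy0
  have h0 : a * x0 + b * y0 + c = 0 := by
    rw [hx0, hy0]; field_simp; rw [hNdef]; ring
  let g : Fin 2 → Polynomial ℝ := fun i =>
    if i = 0 then Polynomial.C b * Polynomial.X + Polynomial.C x0
    else Polynomial.C (-a) * Polynomial.X + Polynomial.C y0
  let φ : Poly2 →ₐ[ℝ] Polynomial ℝ := aeval g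
  let T : Poly2 := C (b / N) * (X 0 - C x0) - C (a / N) * (X 1 - C y0)
  let ψ : Polynomial ℝ →ₐ[ℝ] Poly2 := Polynomial.aeval T
  have hφp : φ p = 0 := by
    have hev : ∀ A : ℝ × ℝ, evalPt l A = 0 →
        (φ p).eval ((b * (A.1 - x0) - a * (A.2 - y0)) / N) = evalPt p A := by
      intro A hA
      have hA' : a * A.1 + b * A.2 + c = 0 := by
        rw [e] at hA; simpa [evalPt] using hA
      have hd : a * (A.1 - x0) + b * (A.2 - y0) = 0 := by linarith
      set t := (b * (A.1 - x0) - a * (A.2 - y0)) / N with ht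
      have t1 : b * t + x0 = A.1 := by
        have : b * t = A.1 - x0 := by
          rw [ht]; field_simp; rw [hNdef]
          linear_combination -a * hd
        linarith
      have t2 : (-a) * t + y0 = A.2 := by
        have : (-a) * t = A.2 - y0 := by
          rw [ht]; field_simp; rw [hNdef]
          linear_combination -b * hd
        linarith
      have : ((Polynomial.aeval t).comp φ : Poly2 →ₐ[ℝ] ℝ) =
          aeval (fun i : Fin 2 => if i = 0 then A.1 else A.2) := by
        ext i
        fin_cases i
        · simp [φ, g, t1]
        · simpa [φ, g] using t2
      have h2 := DFunLike.congr_fun this p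
      simp only [AlgHom.comp_apply] at h2
      rw [Polynomial.coe_aeval_eq_eval] at h2
      rw [h2, evalPt, MvPolynomial.aeval_eq_eval]
    have hdeg : (φ p).natDegree ≤ d := by
      have := MvPolynomial.aeval_natDegree_le p hp (n := 1) g (by
        intro i
        simp only [g]
        split_ifs <;> exact Polynomial.natDegree_linear_le)
      simpa using this
    classical
    have hinj : Set.InjOn (fun A : ℝ × ℝ => (b * (A.1 - x0) - a * (A.2 - y0)) / N) (S : Set (ℝ × ℝ)) := by
      intro A hA B hB hAB
      have hA' : a * A.1 + b * A.2 + c = 0 := by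
        have := hSl A hA
        rw [e] at this; simpa [evalPt] using this
      have hB' : a * B.1 + b * B.2 + c = 0 := by
        have := hSl B hB
        rw [e] at this; simpa [evalPt] using this
      simp only at hAB
      have hAB' : b * (A.1 - x0) - a * (A.2 - y0) = b * (B.1 - x0) - a * (B.2 - y0) := by
        field_simp at hAB; exact hAB
      have e1 : N * (A.1 - B.1) = 0 := by
        rw [hNdef]; linear_combination b * hAB' + a * hA' - a * hB'
      have e2 : N * (A.2 - B.2) = 0 := by
        rw [hNdef]; linear_combination -a * hAB' + b * hA' - b * hB'
      have e1' := (mul_eq_zero.mp e1).resolve_left hN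
      have e2' := (mul_eq_zero.mp e2).resolve_left hN
      exact Prod.ext (by linarith) (by linarith)
    by_contra hne
    have hsub : S.image (fun A : ℝ × ℝ => (b * (A.1 - x0) - a * (A.2 - y0)) / N)
        ⊆ (φ p).roots.toFinset := by
      intro t ht
      obtain ⟨A, hA, rfl⟩ := Finset.mem_image.mp ht
      simp only [Multiset.mem_toFinset]
      rw [Polynomial.mem_roots hne, Polynomial.IsRoot, hev A (hSl A hA), hSp A hA]
    have h1 := Finset.card_le_card hsub
    rw [Finset.card_image_of_injOn hinj] at h1
    have h2 := Multiset.toFinset_card_le (φ p).roots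
    have h3 := Polynomial.card_roots' (φ p)
    omega
  have hid : (Ideal.Quotient.mkₐ ℝ (Ideal.span {l})).comp (ψ.comp φ) =
      Ideal.Quotient.mkₐ ℝ (Ideal.span {l}) := by
    have hC : ∀ x y : ℝ, x = y → (C x : Poly2) = C y := by intro x y h; rw [h]
    ext i
    simp only [AlgHom.comp_apply, Ideal.Quotient.mkₐ_eq_mk]
    rw [Ideal.Quotient.mk_eq_mk_iff_sub_mem, Ideal.mem_span_singleton]
    have hl2 : l = C a * (X 0 - C x0) + C b * (X 1 - C y0) := by
      rw [e]
      have : (C c : Poly2) = - (C a * C x0 + C b * C y0) := by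
        rw [← C_mul, ← C_mul, ← C_add, ← C_neg]; exact hC _ _ (by linarith)
      rw [this]; ring
    have k1 : (C (b * (b / N)) : Poly2) = 1 - C (a / N) * C a := by
      rw [← C_mul, ← C_1, ← C_sub]; apply hC; field_simp; rw [hNdef]; ring
    have k2 : (C (a * (a / N)) : Poly2) = 1 - C (b / N) * C b := by
      rw [← C_mul, ← C_1, ← C_sub]; apply hC; field_simp; rw [hNdef]; ring
    have k3 : (C (b * (a / N)) : Poly2) = C (a / N) * C b := by
      rw [← C_mul]; apply hC; ring
    have k4 : (C (a * (b / N)) : Poly2) = C (b / N) * C a := by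
      rw [← C_mul]; apply hC; ring
    rw [C_mul] at k1 k2 k3 k4
    fin_cases i
    · refine ⟨- C (a / N), ?_⟩
      have : ψ (φ (X 0)) = C b * T + C x0 := by
        simp [φ, ψ, g, MvPolynomial.algebraMap_eq]
      refine Eq.trans (congrArg (· - X 0) this) ?_
      rw [hl2]
      simp only [T]
      linear_combination (X 0 - C x0) * k1 - (X 1 - C y0) * k3
    · refine ⟨- C (b / N), ?_⟩
      have : ψ (φ (X 1)) = - C a * T + C y0 := by
        simp [φ, ψ, g, MvPolynomial.algebraMap_eq]
      refine Eq.trans (congrArg (· - X 1) this) ?_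
      rw [hl2]
      simp only [T]
      linear_combination (X 1 - C y0) * k2 - (X 0 - C x0) * k4
  have h2 := DFunLike.congr_fun hid p
  simp only [AlgHom.comp_apply, hφp, map_zero] at h2
  rw [← Ideal.mem_span_singleton, ← Ideal.Quotient.eq_zero_iff_mem]
  exact h2.symm

/-- Two lines sharing two points divide each other. -/
lemma line_dvd_line {l m : Poly2} (hl : l.totalDegree = 1) (hm : m.totalDegree = 1)
    {A B : ℝ × ℝ} (hAB : A ≠ B) (h1 : evalPt l A = 0) (h2 : evalPt l B = 0)
    (h3 : evalPt m A = 0) (h4 : evalPt m B = 0) : l ∣ m := by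
  classical
  apply line_dvd hl hm.le {A, B}
  · rw [Finset.card_pair hAB]; norm_num
  · simp [h1, h2]
  · simp [h3, h4]

lemma zeroSet_eq_of_dvd {l m : Poly2} (hl : l.totalDegree = 1) (hm : m.totalDegree = 1)
    (h : l ∣ m) : zeroSet l = zeroSet m := by
  obtain ⟨q, rfl⟩ := h
  have hq : q ≠ 0 := by rintro rfl; simp at hm
  have := totalDegree_mul_of_isDomain (line_ne_zero hl) hq
  obtain ⟨c, hc, rfl⟩ := const_isUnit hq (by omega)
  ext A
  simp [zeroSet, evalPt_mul, evalPt_C, hc]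

lemma line_meet_unique {l m : Poly2} (hl : l.totalDegree = 1) (hm : m.totalDegree = 1)
    (hne : zeroSet l ≠ zeroSet m)
    {A B : ℝ × ℝ} (h1 : evalPt l A = 0) (h2 : evalPt l B = 0)
    (h3 : evalPt m A = 0) (h4 : evalPt m B = 0) : A = B := by
  by_contra hAB
  exact hne (zeroSet_eq_of_dvd hl hm (line_dvd_line hl hm hAB h1 h2 h3 h4))

lemma totalDegree_prod_lines {ι : Type*} (s : Finset ι) (f : ι → Poly2)
    (hf : ∀ i ∈ s, (f i).totalDegree = 1) :
    (∏ i ∈ s, f i).totalDegree = s.card := by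
  classical
  induction s using Finset.induction_on with
  | empty => simp
  | insert a s ha ih =>
    rw [Finset.prod_insert ha, totalDegree_mul_of_isDomain, ih, hf a (by simp),
      Finset.card_insert_of_notMem ha, add_comm]
    · intro i hi; exact hf i (by simp [hi])
    · exact line_ne_zero (hf a (by simp))
    · rw [Finset.prod_ne_zero_iff]
      intro i hi; exact line_ne_zero (hf i (by simp [hi]))

lemma degree_quot {f q : Poly2} {d e : ℕ} (h : (f * q).totalDegree ≤ d) (hfq : f * q ≠ 0)
    (hf : f.totalDegree = e) : e + q.totalDegree ≤ d := by
  rw [totalDegree_mul_of_isDomain (left_ne_zero_of_mul hfq) (right_ne_zero_of_mul hfq)] at h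
  omega

lemma prod_lines_dvd {ι : Type*} (s : Finset ι) (f : ι → Poly2) (p : Poly2)
    (hf : ∀ i ∈ s, (f i).totalDegree = 1)
    (hne : ∀ i ∈ s, ∀ j ∈ s, i ≠ j → zeroSet (f i) ≠ zeroSet (f j))
    (hd : ∀ i ∈ s, f i ∣ p) : ∏ i ∈ s, f i ∣ p := by
  classical
  induction s using Finset.induction_on generalizing p with
  | empty => simp
  | insert a s ha ih =>
    obtain ⟨q, rfl⟩ := hd a (by simp)
    rw [Finset.prod_insert ha]
    apply mul_dvd_mul_left
    apply ih
    · intro i hi; exact hf i (by simp [hi])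
    · intro i hi j hj; exact hne i (by simp [hi]) j (by simp [hj])
    · intro i hi
      have hp : Prime (f i) := (line_irreducible (hf i (by simp [hi]))).prime
      rcases hp.dvd_or_dvd (hd i (by simp [hi])) with h | h
      · exfalso
        refine hne i (by simp [hi]) a (by simp) ?_
          (zeroSet_eq_of_dvd (hf i (by simp [hi])) (hf a (by simp)) h)
        rintro rfl; exact ha hi
      · exact h

end AlgebraPart

section GeometryPart

lemma fund_ne_zero {n : ℕ} {X : Finset (ℝ × ℝ)} {A : ℝ × ℝ} {p : Poly2}
    (h : IsFund n X A p) : p ≠ 0 := by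
  rintro rfl
  have := h.2.1
  rw [evalPt_zero] at this
  norm_num at this

lemma fund_dvd {n : ℕ} {X : Finset (ℝ × ℝ)} {l p : Poly2} {B : ℝ × ℝ}
    (hl : IsMaximalLine n X l) (hp : IsFund n X B p) (hB : evalPt l B ≠ 0) : l ∣ p := by
  apply line_dvd hl.1 hp.1 (nodesOn X l)
  · rw [hl.2]; omega
  · intro A hA; exact (mem_nodesOn.mp hA).2
  · intro A hA
    apply hp.2.2 A (mem_nodesOn.mp hA).1
    rintro rfl
    exact hB (mem_nodesOn.mp hA).2

lemma max_meet {n : ℕ} (hn : 2 ≤ n) {X : Finset (ℝ × ℝ)} (hX : IsGC n X) {l m : Poly2}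
    (hl : IsMaximalLine n X l) (hm : IsMaximalLine n X m) :
    ∃ P ∈ X, evalPt l P = 0 ∧ evalPt m P = 0 := by
  classical
  by_contra! hcon
  have hne : (nodesOn X l).Nonempty := by
    rw [← Finset.card_pos, hl.2]; omega
  obtain ⟨A, hA⟩ := hne
  obtain ⟨hAX, hAl⟩ := mem_nodesOn.mp hA
  obtain ⟨p, hp, -⟩ := hX.2 A hAX
  obtain ⟨q, hq⟩ := fund_dvd hm hp (hcon A hAX hAl)
  have hp0 := fund_ne_zero hp
  have hdeg := degree_quot (hq ▸ hp.1) (hq ▸ hp0) hm.1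
  have : l ∣ q := by
    apply line_dvd hl.1 (le_refl _) ((nodesOn X l).erase A)
    · rw [Finset.card_erase_of_mem hA, hl.2]; omega
    · intro B hB; exact (mem_nodesOn.mp (Finset.mem_of_mem_erase hB)).2
    · intro B hB
      obtain ⟨hBX, hBl⟩ := mem_nodesOn.mp (Finset.mem_of_mem_erase hB)
      have h0 := hp.2.2 B hBX (Finset.ne_of_mem_erase hB)
      rw [hq, evalPt_mul] at h0
      exact (mul_eq_zero.mp h0).resolve_left (hcon B hBX hBl)
  obtain ⟨r, hr⟩ := this
  have h1 := hp.2.1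
  rw [hq, hr, evalPt_mul, evalPt_mul, hAl] at h1
  norm_num at h1

lemma no_three {n : ℕ} (hn : 2 ≤ n) {X : Finset (ℝ × ℝ)} (hX : IsGC n X) {l m r : Poly2}
    (hl : IsMaximalLine n X l) (hm : IsMaximalLine n X m) (hr : IsMaximalLine n X r)
    (hlm : zeroSet l ≠ zeroSet m) (hlr : zeroSet l ≠ zeroSet r) (hmr : zeroSet m ≠ zeroSet r)
    {P : ℝ × ℝ} (hPX : P ∈ X)
    (h1 : evalPt l P = 0) (h2 : evalPt m P = 0) (h3 : evalPt r P = 0) : False := by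
  classical
  have hPl : P ∈ nodesOn X l := mem_nodesOn.mpr ⟨hPX, h1⟩
  have hne : ((nodesOn X l).erase P).Nonempty := by
    rw [← Finset.card_pos, Finset.card_erase_of_mem hPl, hl.2]; omega
  obtain ⟨A, hA⟩ := hne
  have hAP := Finset.ne_of_mem_erase hA
  obtain ⟨hAX, hAl⟩ := mem_nodesOn.mp (Finset.mem_of_mem_erase hA)
  obtain ⟨p, hp, -⟩ := hX.2 A hAX
  have offm : ∀ B, evalPt l B = 0 → B ≠ P → evalPt m B ≠ 0 := by
    intro B hB hBP h
    exact hBP (line_meet_unique hl.1 hm.1 hlm hB h1 h h2)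
  have offr : ∀ B, evalPt l B = 0 → B ≠ P → evalPt r B ≠ 0 := by
    intro B hB hBP h
    exact hBP (line_meet_unique hl.1 hr.1 hlr hB h1 h h3)
  obtain ⟨q, hq⟩ := fund_dvd hm hp (offm A hAl hAP)
  have hdr := fund_dvd hr hp (offr A hAl hAP)
  have hp0 := fund_ne_zero hp
  have hrq : r ∣ q := by
    rw [hq] at hdr
    rcases (line_irreducible hr.1).prime.dvd_or_dvd hdr with h | h
    · exact absurd (zeroSet_eq_of_dvd hr.1 hm.1 h).symm hmr
    · exact h
  obtain ⟨t, ht⟩ := hrq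
  have hdeg := degree_quot (hq ▸ hp.1) (hq ▸ hp0) hm.1
  have hq0 : q ≠ 0 := by rintro rfl; simp at hq; exact hp0 hq
  have hdeg2 := degree_quot (d := n - 1) (by rw [← ht]; omega) (ht ▸ hq0) hr.1
  have : l ∣ t := by
    apply line_dvd hl.1 (le_refl _) (((nodesOn X l).erase P).erase A)
    · rw [Finset.card_erase_of_mem hA, Finset.card_erase_of_mem hPl, hl.2]; omega
    · intro B hB
      exact (mem_nodesOn.mp (Finset.mem_of_mem_erase (Finset.mem_of_mem_erase hB))).2
    · intro B hB
      have hBP := Finset.ne_of_mem_erase (Finset.mem_of_mem_erase hB)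
      obtain ⟨hBX, hBl⟩ := mem_nodesOn.mp (Finset.mem_of_mem_erase (Finset.mem_of_mem_erase hB))
      have h0 := hp.2.2 B hBX (Finset.ne_of_mem_erase hB)
      rw [hq, ht, evalPt_mul, evalPt_mul] at h0
      exact (mul_eq_zero.mp ((mul_eq_zero.mp h0).resolve_left (offm B hBl hBP))).resolve_left
        (offr B hBl hBP)
  obtain ⟨u, hu⟩ := this
  have h1 := hp.2.1
  rw [hq, ht, hu, evalPt_mul, evalPt_mul, evalPt_mul, hAl] at h1
  norm_num at h1

lemma exists_lines {n : ℕ} {X : Finset (ℝ × ℝ)} (hmu : mu n X = n + 1) :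
    ∃ L : Fin (n + 1) → Poly2, (∀ i, IsMaximalLine n X (L i)) ∧
      (∀ i j, i ≠ j → zeroSet (L i) ≠ zeroSet (L j)) ∧
      ∀ l, IsMaximalLine n X l → ∃ i, zeroSet l = zeroSet (L i) := by
  unfold mu at hmu
  set M := {L : Set (ℝ × ℝ) | ∃ ℓ : Poly2, IsMaximalLine n X ℓ ∧ L = zeroSet ℓ} with hM
  have hfin : M.Finite := Set.finite_of_ncard_ne_zero (by omega)
  have := hfin.fintype
  have hc : Fintype.card M = n + 1 := by
    rw [← hmu, ← Nat.card_coe_set_eq, Nat.card_eq_fintype_card]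
  let e : Fin (n + 1) ≃ M := (Fintype.equivFinOfCardEq hc).symm
  have hch : ∀ i, ∃ l, IsMaximalLine n X l ∧ ((e i : Set (ℝ × ℝ))) = zeroSet l := fun i => (e i).2
  choose L hL1 hL2 using hch
  refine ⟨L, hL1, ?_, ?_⟩
  · intro i j hij h
    apply hij
    apply e.injective
    apply Subtype.ext
    rw [hL2, hL2, h]
  · intro l hl
    refine ⟨e.symm ⟨zeroSet l, l, hl, rfl⟩, ?_⟩
    rw [← hL2]; simp

lemma on_some_line {n : ℕ} {X : Finset (ℝ × ℝ)} (hX : IsGC n X)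
    (L : Fin (n + 1) → Poly2) (hL : ∀ i, IsMaximalLine n X (L i))
    (hne : ∀ i j, i ≠ j → zeroSet (L i) ≠ zeroSet (L j)) {B : ℝ × ℝ} (hB : B ∈ X) :
    ∃ i, evalPt (L i) B = 0 := by
  by_contra! hcon
  obtain ⟨p, hp, -⟩ := hX.2 B hB
  have := prod_lines_dvd Finset.univ L p (fun i _ => (hL i).1) (fun i _ j _ => hne i j)
    (fun i _ => fund_dvd (hL i) hp (hcon i))
  obtain ⟨q, hq⟩ := this
  have h := degree_quot (hq ▸ hp.1) (hq ▸ fund_ne_zero hp)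
    (totalDegree_prod_lines Finset.univ L (fun i _ => (hL i).1))
  simp at h
  omega

/-- The structure of a Carnicer–Gasca lattice. -/
lemma lattice_structure {n : ℕ} (hn : 2 ≤ n) {X : Finset (ℝ × ℝ)} (hX : IsGC n X)
    (L : Fin (n + 1) → Poly2) (hL : ∀ i, IsMaximalLine n X (L i))
    (hne : ∀ i j, i ≠ j → zeroSet (L i) ≠ zeroSet (L j)) :
    ∃ (O : Fin (n + 1) → Fin (n + 1) → ℝ × ℝ) (F : Fin (n + 1) → ℝ × ℝ),
      (∀ i j, i ≠ j → O i j ∈ X) ∧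
      (∀ i j, i ≠ j → ∀ k, evalPt (L k) (O i j) = 0 ↔ k = i ∨ k = j) ∧
      (∀ i, F i ∈ X) ∧
      (∀ i k, evalPt (L k) (F i) = 0 ↔ k = i) ∧
      (∀ B ∈ X, (∃ i, B = F i) ∨ ∃ i j, i ≠ j ∧ B = O i j) := by
  classical
  have hO : ∀ i j, ∃ P ∈ X, evalPt (L i) P = 0 ∧ evalPt (L j) P = 0 :=
    fun i j => max_meet hn hX (hL i) (hL j)
  choose O hO1 hO2 hO3 using hO
  have hOk : ∀ i j, i ≠ j → ∀ k, evalPt (L k) (O i j) = 0 ↔ k = i ∨ k = j := by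
    intro i j hij k
    constructor
    · intro h
      by_contra! hk
      exact no_three hn hX (hL k) (hL i) (hL j) (hne _ _ hk.1) (hne _ _ hk.2) (hne _ _ hij)
        (hO1 i j) h (hO2 i j) (hO3 i j)
    · rintro (rfl | rfl)
      · exact hO2 _ _
      · exact hO3 _ _
  have hinj : ∀ i, Set.InjOn (O i) ((Finset.univ.erase i : Finset (Fin (n + 1))) : Set (Fin (n + 1))) := by
    intro i j hj j' hj' h
    have hj2 : j ≠ i := by simpa using hj
    have hj2' : j' ≠ i := by simpa using hj'
    have := (hOk i j' hj2'.symm j).mp (by rw [← h]; exact hO3 _ _)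
    exact this.resolve_left hj2
  have hsub : ∀ i, (Finset.univ.erase i).image (O i) ⊆ nodesOn X (L i) := by
    intro i B hB
    obtain ⟨j, -, rfl⟩ := Finset.mem_image.mp hB
    exact mem_nodesOn.mpr ⟨hO1 _ _, hO2 _ _⟩
  have hcard : ∀ i, (nodesOn X (L i) \ (Finset.univ.erase i).image (O i)).card = 1 := by
    intro i
    rw [Finset.card_sdiff_of_subset (hsub i), Finset.card_image_of_injOn (hinj i), (hL i).2,
      Finset.card_erase_of_mem (Finset.mem_univ _), Finset.card_univ, Fintype.card_fin]
    omega
  have hF : ∀ i, ∃ A, nodesOn X (L i) \ (Finset.univ.erase i).image (O i) = {A} :=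
    fun i => Finset.card_eq_one.mp (hcard i)
  choose F hF using hF
  have hFm : ∀ i, F i ∈ nodesOn X (L i) \ (Finset.univ.erase i).image (O i) := by
    intro i; rw [hF i]; simp
  have hFX : ∀ i, F i ∈ X ∧ evalPt (L i) (F i) = 0 := by
    intro i
    exact mem_nodesOn.mp (Finset.mem_sdiff.mp (hFm i)).1
  refine ⟨O, F, fun i j _ => hO1 i j, hOk, fun i => (hFX i).1, ?_, ?_⟩
  · intro i k
    constructor
    · intro h
      by_contra hk
      apply (Finset.mem_sdiff.mp (hFm i)).2
      refine Finset.mem_image.mpr ⟨k, by simp [hk], ?_⟩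
      exact line_meet_unique (hL i).1 (hL k).1 (hne i k (Ne.symm hk)) (hO2 _ _) (hFX i).2
        (hO3 _ _) h
    · rintro rfl; exact (hFX _).2
  · intro B hB
    obtain ⟨i, hi⟩ := on_some_line hX L hL hne hB
    by_cases h : B ∈ (Finset.univ.erase i).image (O i)
    · obtain ⟨j, hj, rfl⟩ := Finset.mem_image.mp h
      right
      exact ⟨i, j, (Finset.ne_of_mem_erase hj).symm, rfl⟩
    · left
      refine ⟨i, ?_⟩
      have : B ∈ nodesOn X (L i) \ (Finset.univ.erase i).image (O i) :=
        Finset.mem_sdiff.mpr ⟨mem_nodesOn.mpr ⟨hB, hi⟩, h⟩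
      rw [hF i] at this
      simpa using this

end GeometryPart

section MainPart

lemma maximal_case {n : ℕ} (hn : 2 ≤ n) {X : Finset (ℝ × ℝ)} (hX : IsGC n X)
    {ℓ : Poly2} (hℓ : IsMaximalLine n X ℓ) :
    (usesSet n X ℓ).card = (n + 1).choose 2 ∧
      ∀ lam : Poly2, IsMaximalLine n X lam →
        (nodesOn (usesSet n X ℓ) lam).card = 0 ∨
          (nodesOn (usesSet n X ℓ) lam).card = n + 1 - 1 := by
  classical
  have hU : usesSet n X ℓ = X \ nodesOn X ℓ := by
    ext B
    rw [mem_usesSet, Finset.mem_sdiff, mem_nodesOn]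
    constructor
    · rintro ⟨hB, p, hp, q, rfl⟩
      refine ⟨hB, ?_⟩
      rintro ⟨-, h⟩
      have := hp.2.1
      rw [evalPt_mul, h] at this
      norm_num at this
    · rintro ⟨hB, h⟩
      obtain ⟨p, hp, -⟩ := hX.2 B hB
      exact ⟨hB, p, hp, fund_dvd hℓ hp (fun h0 => h ⟨hB, h0⟩)⟩
  constructor
  · rw [hU, Finset.card_sdiff_of_subset (fun B hB => (mem_nodesOn.mp hB).1), hℓ.2, hX.1.1]
    have := Nat.choose_succ_succ (n + 1) 1
    simp at this
    have e : (n + 2).choose 2 = (n + 1) + (n + 1).choose 2 := this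
    omega
  · intro lam hlam
    by_cases hz : zeroSet lam = zeroSet ℓ
    · left
      rw [Finset.card_eq_zero, Finset.eq_empty_iff_forall_notMem]
      intro B hB
      obtain ⟨h1, h2⟩ := mem_nodesOn.mp hB
      rw [hU, Finset.mem_sdiff, mem_nodesOn] at h1
      have : B ∈ zeroSet lam := h2
      rw [hz] at this
      exact h1.2 ⟨h1.1, this⟩
    · right
      obtain ⟨P, hPX, h1, h2⟩ := max_meet hn hX hlam hℓ
      have : nodesOn (usesSet n X ℓ) lam = (nodesOn X lam).erase P := by
        ext B
        rw [mem_nodesOn, hU, Finset.mem_sdiff, mem_nodesOn, Finset.mem_erase, mem_nodesOn]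
        constructor
        · rintro ⟨⟨a, b⟩, c⟩
          refine ⟨?_, a, c⟩
          rintro rfl; exact b ⟨a, h2⟩
        · rintro ⟨a, b, c⟩
          refine ⟨⟨b, ?_⟩, c⟩
          rintro ⟨-, h⟩
          exact a (line_meet_unique hlam.1 hℓ.1 hz c h1 h h2)
      rw [this, Finset.card_erase_of_mem (mem_nodesOn.mpr ⟨hPX, h1⟩), hlam.2]

lemma nonmaximal_uses {n : ℕ} {X : Finset (ℝ × ℝ)}
    (L : Fin (n + 1) → Poly2) (hL : ∀ i, IsMaximalLine n X (L i))
    (hne : ∀ i j, i ≠ j → zeroSet (L i) ≠ zeroSet (L j))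
    (O : Fin (n + 1) → Fin (n + 1) → ℝ × ℝ) (F : Fin (n + 1) → ℝ × ℝ)
    (hOX : ∀ i j, i ≠ j → O i j ∈ X)
    (hO : ∀ i j, i ≠ j → ∀ k, evalPt (L k) (O i j) = 0 ↔ k = i ∨ k = j)
    (hFX : ∀ i, F i ∈ X)
    (hF : ∀ i k, evalPt (L k) (F i) = 0 ↔ k = i)
    (hall : ∀ B ∈ X, (∃ i, B = F i) ∨ ∃ i j, i ≠ j ∧ B = O i j)
    {ℓ : Poly2} (hℓ : ℓ.totalDegree = 1) (hℓL : ∀ i, zeroSet ℓ ≠ zeroSet (L i)) :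
    (∀ i, ¬ Uses n X ℓ (F i)) ∧
    (∀ i j, i ≠ j → (Uses n X ℓ (O i j) ↔ evalPt ℓ (F i) = 0 ∧ evalPt ℓ (F j) = 0)) := by
  classical
  have hprime := (line_irreducible hℓ).prime
  have hnd : ∀ s : Finset (Fin (n + 1)), ¬ ℓ ∣ ∏ i ∈ s, L i := by
    intro s h
    obtain ⟨i, -, hi⟩ := (hprime.dvd_finsetProd_iff _).mp h
    exact hℓL i (zeroSet_eq_of_dvd hℓ (hL i).1 hi)
  have hOsymm : ∀ i j, i ≠ j → O i j = O j i := by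
    intro i j hij
    exact line_meet_unique (hL i).1 (hL j).1 (hne i j hij) (by rw [hO i j hij]; simp)
      (by rw [hO j i hij.symm]; simp) (by rw [hO i j hij]; simp) (by rw [hO j i hij.symm]; simp)
  constructor
  · rintro i ⟨p, hp, hdp⟩
    have hd := prod_lines_dvd (Finset.univ.erase i) L p (fun i _ => (hL i).1)
      (fun i _ j _ => hne i j)
      (fun k hk => fund_dvd (hL k) hp (by rw [Ne, hF]; exact Finset.ne_of_mem_erase hk))
    obtain ⟨q, hq⟩ := hd
    have hp0 := fund_ne_zero hp
    have h := degree_quot (hq ▸ hp.1) (hq ▸ hp0)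
      (totalDegree_prod_lines (Finset.univ.erase i) L (fun i _ => (hL i).1))
    rw [Finset.card_erase_of_mem (Finset.mem_univ _), Finset.card_univ, Fintype.card_fin] at h
    rw [hq] at hdp hp0
    rcases hprime.dvd_or_dvd hdp with h1 | ⟨r, hr⟩
    · exact hnd _ h1
    · have := degree_quot (d := 0) (by rw [← hr]; omega) (hr ▸ right_ne_zero_of_mul hp0) hℓ
      omega
  · intro i j hij
    have hmem : ∀ k, k ∈ (Finset.univ.erase i).erase j ↔ k ≠ j ∧ k ≠ i := by
      intro k; simp
    have hcard : ((Finset.univ.erase i).erase j).card = n - 1 := by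
      rw [Finset.card_erase_of_mem (by simp [hij.symm]),
        Finset.card_erase_of_mem (Finset.mem_univ _), Finset.card_univ, Fintype.card_fin]
      omega
    have hn1 : 1 ≤ n := by
      have h1 := i.2
      have h2 := j.2
      by_contra h
      apply hij
      apply Fin.ext
      omega
    constructor
    · rintro ⟨p, hp, hdp⟩
      have hd := prod_lines_dvd ((Finset.univ.erase i).erase j) L p (fun i _ => (hL i).1)
        (fun i _ j _ => hne i j)
        (fun k hk => fund_dvd (hL k) hp (by
          rw [Ne, hO i j hij]
          have := (hmem k).mp hk
          tauto))
      obtain ⟨q, hq⟩ := hd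
      have hp0 := fund_ne_zero hp
      have h := degree_quot (hq ▸ hp.1) (hq ▸ hp0)
        (totalDegree_prod_lines ((Finset.univ.erase i).erase j) L (fun i _ => (hL i).1))
      rw [hcard] at h
      rw [hq] at hdp hp0
      rcases hprime.dvd_or_dvd hdp with h1 | ⟨r, hr⟩
      · exact absurd h1 (hnd _)
      · have hq0 := right_ne_zero_of_mul hp0
        rw [hr] at hq0
        have := degree_quot (d := 1) (by rw [← hr]; omega) hq0 hℓ
        obtain ⟨c, hc, rfl⟩ := const_isUnit (right_ne_zero_of_mul hq0) (by omega)
        have key : ∀ m, m = i ∨ m = j → evalPt ℓ (F m) = 0 := by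
          intro m hm
          have h0 := hp.2.2 (F m) (hFX m) (by
            intro he
            have a1 := (hF m i).mp (by rw [he, hO i j hij]; simp)
            have a2 := (hF m j).mp (by rw [he, hO i j hij]; simp)
            exact hij (a1.trans a2.symm))
          rw [hq, hr, evalPt_mul, evalPt_mul, evalPt_C, evalPt_prod] at h0
          rcases mul_eq_zero.mp h0 with h0 | h0
          · obtain ⟨k, hk, hk0⟩ := Finset.prod_eq_zero_iff.mp h0
            rw [hF] at hk0
            have := (hmem k).mp hk
            subst hk0
            tauto
          · exact (mul_eq_zero.mp h0).resolve_right hc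
        exact ⟨key i (Or.inl rfl), key j (Or.inr rfl)⟩
    · rintro ⟨hi, hj⟩
      set Q : Poly2 := (∏ k ∈ (Finset.univ.erase i).erase j, L k) with hQ
      have hFO : F i ≠ O i j := by
        intro he
        have := (hF i j).mp (by rw [he, hO i j hij]; simp)
        exact hij this.symm
      have hv : evalPt (Q * ℓ) (O i j) ≠ 0 := by
        rw [evalPt_mul, hQ, evalPt_prod]
        apply mul_ne_zero
        · rw [Finset.prod_ne_zero_iff]
          intro k hk
          rw [Ne, hO i j hij]
          have := (hmem k).mp hk
          tauto
        · intro h0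
          apply hFO
          exact line_meet_unique hℓ (hL i).1 (hℓL i) hi h0 (by rw [hF])
            (by rw [hO i j hij]; simp)
      refine ⟨C (evalPt (Q * ℓ) (O i j))⁻¹ * (Q * ℓ), ⟨?_, ?_, ?_⟩, ?_⟩
      · have h1 := totalDegree_mul (C (evalPt (Q * ℓ) (O i j))⁻¹) (Q * ℓ)
        have h2 := totalDegree_mul Q ℓ
        have h3 := totalDegree_prod_lines ((Finset.univ.erase i).erase j) L (fun i _ => (hL i).1)
        rw [← hQ, hcard] at h3
        rw [totalDegree_C] at h1
        omega
      · rw [evalPt_mul, evalPt_C, inv_mul_cancel₀ hv]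
      · intro B hB hBne
        rw [evalPt_mul, evalPt_mul Q ℓ B]
        have hQ0 : ∀ k, k ≠ i → k ≠ j → evalPt (L k) B = 0 → evalPt Q B = 0 := by
          intro k h1 h2 h3
          rw [hQ, evalPt_prod]
          exact Finset.prod_eq_zero ((hmem k).mpr ⟨h2, h1⟩) h3
        rcases hall B hB with ⟨m, rfl⟩ | ⟨a, b, hab, rfl⟩
        · by_cases h1 : m = i
          · subst h1; rw [hi]; ring
          by_cases h2 : m = j
          · subst h2; rw [hj]; ring
          rw [hQ0 m h1 h2 (by rw [hF])]; ring
        · have ha0 : evalPt (L a) (O a b) = 0 := by rw [hO a b hab]; simp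
          have hb0 : evalPt (L b) (O a b) = 0 := by rw [hO a b hab]; simp
          by_cases h1 : a ≠ i ∧ a ≠ j
          · rw [hQ0 a h1.1 h1.2 ha0]; ring
          by_cases h2 : b ≠ i ∧ b ≠ j
          · rw [hQ0 b h2.1 h2.2 hb0]; ring
          exfalso
          have hc : (a = i ∧ b = j) ∨ (a = j ∧ b = i) := by
            rw [not_and_or, not_not, not_not] at h1 h2
            rcases h1 with rfl | rfl <;> rcases h2 with rfl | rfl <;> tauto
          rcases hc with ⟨rfl, rfl⟩ | ⟨rfl, rfl⟩
          · exact hBne rfl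
          · exact hBne (hOsymm _ _ hab)
      · exact Dvd.intro_left (C (evalPt (Q * ℓ) (O i j))⁻¹ * Q) (by ring)

end MainPart

lemma nonmaximal_case {n k : ℕ} (hn : 2 ≤ n) {X : Finset (ℝ × ℝ)} (hX : IsGC n X)
    (hmu : mu n X = n + 1) {ℓ : Poly2} (hℓ : IsKNodeLine X ℓ k) (hk : k ≠ n + 1) :
    ∃ s : ℕ, (2 * k : ℤ) - n - 1 ≤ (s : ℤ) ∧ s ≤ k ∧
      (usesSet n X ℓ).card = s.choose 2 ∧
      ∀ lam : Poly2, IsMaximalLine n X lam →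
        (nodesOn (usesSet n X ℓ) lam).card = 0 ∨
          (nodesOn (usesSet n X ℓ) lam).card = s - 1 := by
  classical
  obtain ⟨L, hL, hne, hLall⟩ := exists_lines hmu
  obtain ⟨O, F, hOX, hO, hFX, hF, hall⟩ := lattice_structure hn hX L hL hne
  have nodes_congr : ∀ (Y : Finset (ℝ × ℝ)) (a b : Poly2), zeroSet a = zeroSet b →
      nodesOn Y a = nodesOn Y b := by
    intro Y a b h
    ext B
    rw [mem_nodesOn, mem_nodesOn]
    have : B ∈ zeroSet a ↔ B ∈ zeroSet b := by rw [h]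
    exact and_congr_right (fun _ => this)
  have hℓL : ∀ i, zeroSet ℓ ≠ zeroSet (L i) := by
    intro i h
    apply hk
    rw [← hℓ.2, nodes_congr X _ _ h, (hL i).2]
  obtain ⟨hUF, hUO⟩ := nonmaximal_uses L hL hne O F hOX hO hFX hF hall hℓ.1 hℓL
  let S : Finset (Fin (n + 1)) := Finset.univ.filter (fun i => evalPt ℓ (F i) = 0)
  have hS : ∀ i, i ∈ S ↔ evalPt ℓ (F i) = 0 := by intro i; simp [S]
  let I : ℝ × ℝ → Finset (Fin (n + 1)) := fun B => Finset.univ.filter (fun i => evalPt (L i) B = 0)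
  have hI : ∀ B i, i ∈ I B ↔ evalPt (L i) B = 0 := by intro B i; simp [I]
  have hIF : ∀ i, I (F i) = {i} := by
    intro i; ext m; rw [hI, hF]; simp
  have incidenceO : ∀ i j, i ≠ j → I (O i j) = {i, j} := by
    intro i j hij; ext m; rw [hI, hO i j hij]; simp
  have hFinj : Function.Injective F := by
    intro i j h
    have := hIF i
    rw [h, hIF j] at this
    exact (Finset.singleton_injective this).symm
  have hmemU : ∀ B, B ∈ usesSet n X ℓ ↔ ∃ i j, i ≠ j ∧ i ∈ S ∧ j ∈ S ∧ B = O i j := by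
    intro B
    rw [mem_usesSet]
    constructor
    · rintro ⟨hB, hu⟩
      rcases hall B hB with ⟨i, rfl⟩ | ⟨i, j, hij, rfl⟩
      · exact absurd hu (hUF i)
      · have := (hUO i j hij).mp hu
        exact ⟨i, j, hij, (hS i).mpr this.1, (hS j).mpr this.2, rfl⟩
    · rintro ⟨i, j, hij, hi, hj, rfl⟩
      exact ⟨hOX i j hij, (hUO i j hij).mpr ⟨(hS i).mp hi, (hS j).mp hj⟩⟩
  have hOeq : ∀ i j, i ≠ j → ∀ P, evalPt (L i) P = 0 → evalPt (L j) P = 0 → P = O i j := by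
    intro i j hij P h1 h2
    exact line_meet_unique (hL i).1 (hL j).1 (hne i j hij) h1 (by rw [hO i j hij]; simp) h2
      (by rw [hO i j hij]; simp)
  refine ⟨S.card, ?_, ?_, ?_, ?_⟩
  · -- the counting bound
    set K := nodesOn X ℓ with hK
    have hdisj : ∀ B ∈ K, ∀ B' ∈ K, B ≠ B' → Disjoint (I B) (I B') := by
      intro B hB B' hB' hBB
      rw [Finset.disjoint_left]
      intro i h1 h2
      exact hBB (line_meet_unique hℓ.1 (hL i).1 (hℓL i) (mem_nodesOn.mp hB).2
        (mem_nodesOn.mp hB').2 ((hI _ _).mp h1) ((hI _ _).mp h2))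
    have h1 : ∑ B ∈ K, (I B).card ≤ n + 1 := by
      rw [← Finset.card_biUnion hdisj]
      refine (Finset.card_le_univ _).trans ?_
      simp
    have h2 : ∑ B ∈ K, 2 ≤ ∑ B ∈ K, ((I B).card + if B ∈ S.image F then 1 else 0) := by
      apply Finset.sum_le_sum
      intro B hB
      obtain ⟨hBX, hB0⟩ := mem_nodesOn.mp hB
      rcases hall B hBX with ⟨i, rfl⟩ | ⟨i, j, hij, rfl⟩
      · rw [if_pos (Finset.mem_image.mpr ⟨i, (hS i).mpr hB0, rfl⟩), hIF]
        simp
      · rw [incidenceO i j hij, Finset.card_pair hij]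
        omega
    have h3 : ∑ B ∈ K, (if B ∈ S.image F then 1 else 0) ≤ S.card := by
      rw [← Finset.card_filter]
      refine (Finset.card_le_card (t := S.image F) ?_).trans Finset.card_image_le
      intro B hB
      exact (Finset.mem_filter.mp hB).2
    rw [Finset.sum_add_distrib, Finset.sum_const, hℓ.2, smul_eq_mul] at h2
    omega
  · rw [← hℓ.2]
    apply Finset.card_le_card_of_injOn F
    · intro i hi
      exact mem_nodesOn.mpr ⟨hFX i, (hS i).mp hi⟩
    · exact hFinj.injOn
  · rw [← Finset.card_powersetCard]
    refine Finset.card_bij (fun B _ => I B) ?_ ?_ ?_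
    · intro B hB
      obtain ⟨i, j, hij, hi, hj, rfl⟩ := (hmemU B).mp hB
      rw [incidenceO i j hij, Finset.mem_powersetCard, Finset.card_pair hij]
      refine ⟨?_, rfl⟩
      intro m hm
      rcases Finset.mem_insert.mp hm with rfl | hm
      · exact hi
      · rw [Finset.mem_singleton.mp hm]; exact hj
    · intro B hB B' hB' h
      obtain ⟨i, j, hij, hi, hj, rfl⟩ := (hmemU B).mp hB
      have h1 : i ∈ I B' := by rw [← h, incidenceO i j hij]; simp
      have h2 : j ∈ I B' := by rw [← h, incidenceO i j hij]; simp
      exact (hOeq i j hij B' ((hI _ _).mp h1) ((hI _ _).mp h2)).symm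
    · intro T hT
      obtain ⟨hTS, hT2⟩ := Finset.mem_powersetCard.mp hT
      obtain ⟨i, j, hij, rfl⟩ := Finset.card_eq_two.mp hT2
      exact ⟨O i j, (hmemU _).mpr ⟨i, j, hij, hTS (by simp), hTS (by simp), rfl⟩, incidenceO i j hij⟩
  · intro lam hlam
    obtain ⟨i, hi⟩ := hLall lam hlam
    rw [nodes_congr _ _ _ hi]
    by_cases hiS : i ∈ S
    · right
      rw [← Finset.card_erase_of_mem hiS]
      symm
      refine Finset.card_bij (fun j _ => O i j) ?_ ?_ ?_
      · intro j hj
        obtain ⟨h1, h2⟩ := Finset.mem_erase.mp hj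
        exact mem_nodesOn.mpr ⟨(hmemU _).mpr ⟨i, j, h1.symm, hiS, h2, rfl⟩,
          by rw [hO i j h1.symm]; simp⟩
      · intro j hj j' hj' h
        have h1 := (Finset.mem_erase.mp hj).1
        have h1' := (Finset.mem_erase.mp hj').1
        have : j ∈ I (O i j') := by
          rw [← h, incidenceO i j h1.symm]; simp
        rw [incidenceO i j' h1'.symm] at this
        simpa [h1] using this
      · intro B hB
        obtain ⟨hBU, hB0⟩ := mem_nodesOn.mp hB
        obtain ⟨a, b, hab, ha, hb, rfl⟩ := (hmemU B).mp hBU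
        have hA0 : evalPt (L a) (O a b) = 0 := by rw [hO a b hab]; simp
        have hB0' : evalPt (L b) (O a b) = 0 := by rw [hO a b hab]; simp
        rcases (hO a b hab i).mp hB0 with rfl | rfl
        · exact ⟨b, Finset.mem_erase.mpr ⟨hab.symm, hb⟩, rfl⟩
        · exact ⟨a, Finset.mem_erase.mpr ⟨hab, ha⟩, (hOeq _ _ hab.symm _ hB0' hA0).symm⟩
    · left
      rw [Finset.card_eq_zero, Finset.eq_empty_iff_forall_notMem]
      intro B hB
      obtain ⟨hBU, hB0⟩ := mem_nodesOn.mp hB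
      obtain ⟨a, b, hab, ha, hb, rfl⟩ := (hmemU B).mp hBU
      rcases (hO a b hab i).mp hB0 with rfl | rfl
      · exact hiS ha
      · exact hiS hb

/-- For a Carnicer–Gasca lattice of degree `n ≥ 2` (a `GC_n` set with exactly
`n+1` maximal lines) and a `k`-node line `ℓ` with `2 ≤ k ≤ n+1`, there is `s` with
`2k - n - 1 ≤ s ≤ k` such that `|X_ℓ| = (s choose 2)` and every maximal line contains
either `0` or `s - 1` nodes of `X_ℓ`. -/
theorem stmt_8 (n k : ℕ) (hn : 2 ≤ n)
    (X : Finset (ℝ × ℝ)) (hX : IsGC n X) (hmu : mu n X = n + 1)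
    (ℓ : Poly2) (hk2 : 2 ≤ k) (hkn : k ≤ n + 1) (hℓ : IsKNodeLine X ℓ k) :
    ∃ s : ℕ, (2 * k : ℤ) - n - 1 ≤ (s : ℤ) ∧ s ≤ k ∧
      (usesSet n X ℓ).card = s.choose 2 ∧
      ∀ lam : Poly2, IsMaximalLine n X lam →
        (nodesOn (usesSet n X ℓ) lam).card = 0 ∨
          (nodesOn (usesSet n X ℓ) lam).card = s - 1 := by
  by_cases hk : k = n + 1
  · subst hk
    obtain ⟨h1, h2⟩ := maximal_case hn hX hℓ
    exact ⟨n + 1, by push_cast; omega, le_refl _, h1, h2⟩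
  · exact nonmaximal_case hn hX hmu hℓ hk
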